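/- arXiv:1906.10639 — 2 statements merged into one kernel-verified Lean document; each statement's English description precedes it below -/
import Mathlib

section
/- Fix an integer D ≥ 0 and a real number c ∈ (0,1). For each N, with M = N + D, let H_N(c) = Σ_{j=0}^{N} (∂q_{N,M}(j,c)/∂c)² / q_{N,M}(j,c) be the Fisher information of the distribution q_{N,M}(·,c) with respect to the parameter c (each q_{N,M}(j,·) is a polynomial in c, and q_{N,M}(j,c) > 0 for c ∈ (0,1)). Then lim_{N→∞} H_N(c)/(2N+D) = 1/(4c(1−c)); that is, the Fisher information equals (M+N)/(4c(1−c)) to leading order. -/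
open Finset Filter

/-- The outcome distribution `q_{N,M}(j,c)` of the optimal (weak Schur sampling)
measurement for estimating the squared overlap `c`, given `N` and `M ≥ N` copies. -/
noncomputable def overlapDist (N M j : ℕ) (c : ℝ) : ℝ :=
  (((M - N + 2 * j + 1) * Nat.factorial N * Nat.factorial M : ℕ) : ℝ) /
      ((Nat.factorial (N - j) * Nat.factorial (M + j + 1) : ℕ) : ℝ) *
    ∑ m ∈ Finset.range (M - N + j + 1),
      ((Nat.choose (M - N + j) m * Nat.choose (j + m) m : ℕ) : ℝ) * c ^ m * (1 - c) ^ (M - m)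

/-- The Fisher information of the family `c ↦ q_{N,M}(·,c)`:
`H_N(c) = Σ_{j=0}^N (∂_c q_{N,M}(j,c))² / q_{N,M}(j,c)`. -/
noncomputable def fisherInfo (N M : ℕ) (c : ℝ) : ℝ :=
  ∑ j ∈ Finset.range (N + 1),
    (deriv (fun x => overlapDist N M j x) c) ^ 2 / overlapDist N M j c

section Polynomials

open Polynomial

theorem Polynomial.Splits.derivative_real {p : ℝ[X]} (hp : p.Splits) :
    (derivative p).Splits := by
  by_cases h : p.natDegree = 0
  · rw [derivative_of_natDegree_zero h]
    exact Splits.zero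
  · refine splits_iff_card_roots.2 (le_antisymm (card_roots' _) ?_)
    have h₁ := card_roots_le_derivative p
    have h₂ := natDegree_derivative_lt h
    rw [splits_iff_card_roots.1 hp] at h₁
    omega

/-- The second derivative of `log p` at `x`. -/
noncomputable def logDerivTwo (p : ℝ[X]) (x : ℝ) : ℝ :=
  (derivative (derivative p)).eval x / p.eval x - ((derivative p).eval x / p.eval x) ^ 2

/-- The third derivative of `log p` at `x`. -/
noncomputable def logDerivThree (p : ℝ[X]) (x : ℝ) : ℝ :=
  (derivative (derivative (derivative p))).eval x / p.eval x
    - 3 * ((derivative p).eval x / p.eval x) * ((derivative (derivative p)).eval x / p.eval x)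
    + 2 * ((derivative p).eval x / p.eval x) ^ 3

theorem logDerivTwo_mul_X_sub_C {p : ℝ[X]} {x r : ℝ} (hp : p.eval x ≠ 0) (hr : x - r ≠ 0) :
    logDerivTwo ((X - C r) * p) x = logDerivTwo p x - 1 / (x - r) ^ 2 := by
  simp only [logDerivTwo, derivative_mul, derivative_add, derivative_sub, derivative_X,
    derivative_C, derivative_one, eval_add, eval_mul, eval_sub, eval_X, eval_C,
    sub_zero, eval_one, eval_zero]
  field_simp
  ring

theorem logDerivThree_mul_X_sub_C {p : ℝ[X]} {x r : ℝ} (hp : p.eval x ≠ 0) (hr : x - r ≠ 0) :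
    logDerivThree ((X - C r) * p) x = logDerivThree p x + 2 / (x - r) ^ 3 := by
  simp only [logDerivThree, derivative_mul, derivative_add, derivative_sub, derivative_X,
    derivative_C, derivative_one, derivative_zero, eval_add, eval_mul, eval_sub, eval_X, eval_C,
    sub_zero, eval_one, eval_zero]
  field_simp
  ring

theorem abs_logDeriv_multiset_prod_le {a x : ℝ} (ha : a ≠ 0) (hx : 0 < x) (s : Multiset ℝ)
    (hs : ∀ r ∈ s, r ≤ 0) :
    ((s.map fun r => X - C r).prod * C a).eval x ≠ 0 ∧
    |logDerivTwo ((s.map fun r => X - C r).prod * C a) x| ≤ s.card / x ^ 2 ∧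
    |logDerivThree ((s.map fun r => X - C r).prod * C a) x| ≤ 2 * s.card / x ^ 3 := by
  induction s using Multiset.induction_on with
  | empty => simp [logDerivTwo, logDerivThree, ha]
  | cons r s ih =>
    obtain ⟨h₀, h₁, h₂⟩ := ih fun t ht => hs t (Multiset.mem_cons_of_mem ht)
    have hr : x ≤ x - r := by linarith [hs r (Multiset.mem_cons_self r s)]
    have hr₀ : 0 < x - r := hx.trans_le hr
    have h₃ : |1 / (x - r) ^ 2| ≤ 1 / x ^ 2 := by
      rw [abs_of_nonneg (by positivity)]; gcongr
    have h₄ : |2 / (x - r) ^ 3| ≤ 2 / x ^ 3 := by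
      rw [abs_of_nonneg (by positivity)]; gcongr
    rw [Multiset.map_cons, Multiset.prod_cons, mul_assoc, logDerivTwo_mul_X_sub_C h₀ hr₀.ne',
      logDerivThree_mul_X_sub_C h₀ hr₀.ne', Multiset.card_cons]
    refine ⟨?_, ?_, ?_⟩
    · rw [eval_mul]
      exact mul_ne_zero (by simpa using hr₀.ne') h₀
    · refine (abs_sub _ _).trans ((add_le_add h₁ h₃).trans_eq ?_)
      push_cast; ring
    · refine (abs_add_le _ _).trans ((add_le_add h₂ h₄).trans_eq ?_)
      push_cast; ring

theorem Polynomial.Splits.abs_logDeriv_le {p : ℝ[X]} (hp : p.Splits) (h₀ : p ≠ 0)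
    (hr : ∀ r ∈ p.roots, r ≤ 0) {x : ℝ} (hx : 0 < x) :
    |logDerivTwo p x| ≤ p.natDegree / x ^ 2 ∧
    |logDerivThree p x| ≤ 2 * p.natDegree / x ^ 3 := by
  have h := abs_logDeriv_multiset_prod_le (leadingCoeff_ne_zero.2 h₀) hx p.roots hr
  rw [mul_comm, ← hp.eq_prod_roots, splits_iff_card_roots.1 hp] at h
  exact h.2

/-- `∑ₘ C(D+j,m) C(j+m,m) Xᵐ`, the Jacobi polynomial `P_{D+j}^{(0,-D)}(1+2X)`. -/
noncomputable def overlapPoly (D j : ℕ) : ℝ[X] :=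
  ∑ m ∈ range (D + j + 1),
    C (((D + j).choose m * (j + m).choose m : ℕ) : ℝ) * X ^ m

theorem coeff_overlapPoly (D j m : ℕ) :
    (overlapPoly D j).coeff m = (D + j).choose m * (j + m).choose m := by
  simp only [overlapPoly, finsetSum_coeff, coeff_C_mul, coeff_X_pow]
  by_cases h : m < D + j + 1
  · simp [h]
  · simp [h, Nat.choose_eq_zero_of_lt (by omega : D + j < m)]

theorem overlapPoly_eq_hasseDeriv (D j : ℕ) :
    overlapPoly D j = hasseDeriv j ((X + C 1) ^ (D + j) * X ^ j) := by
  ext m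
  rw [coeff_overlapPoly, hasseDeriv_coeff, coeff_mul_X_pow, map_one, coeff_X_add_one_pow,
    add_comm j m, Nat.choose_symm_add, mul_comm]

theorem splits_overlapPoly (D j : ℕ) : (overlapPoly D j).Splits := by
  have h : ∀ k (p : ℝ[X]), p.Splits → (derivative^[k] p).Splits := by
    intro k
    induction k with
    | zero => exact fun p hp => hp
    | succ k ih => exact fun p hp => ih _ hp.derivative_real
  have h₁ := h j _ (((Splits.X_add_C (1 : ℝ)).pow (D + j)).mul ((Splits.X (R := ℝ)).pow j))
  rw [← factorial_smul_hasseDeriv, LinearMap.smul_apply, ← overlapPoly_eq_hasseDeriv,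
    nsmul_eq_mul, ← C_eq_natCast] at h₁
  have hj : ((j.factorial : ℕ) : ℝ) ≠ 0 := by positivity
  have h₂ := (Splits.C (((j.factorial : ℕ) : ℝ)⁻¹)).mul h₁
  rwa [← mul_assoc, ← C_mul, inv_mul_cancel₀ hj, C_1, one_mul] at h₂

theorem overlapPoly_eval_pos (D j : ℕ) {x : ℝ} (hx : 0 ≤ x) : 0 < (overlapPoly D j).eval x := by
  simp only [overlapPoly, eval_finsetSum, eval_mul, eval_C, eval_pow, eval_X]
  refine sum_pos' (fun m _ => by positivity) ⟨0, by simp, by simp⟩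

theorem natDegree_overlapPoly_le (D j : ℕ) : (overlapPoly D j).natDegree ≤ D + j :=
  natDegree_sum_le_of_forall_le _ _ fun m hm =>
    (natDegree_C_mul_X_pow_le _ _).trans (by simpa [Nat.lt_succ_iff] using hm)

theorem abs_logDeriv_overlapPoly_le (D j : ℕ) {x : ℝ} (hx : 0 < x) :
    |logDerivTwo (overlapPoly D j) x| ≤ (D + j : ℕ) / x ^ 2 ∧
    |logDerivThree (overlapPoly D j) x| ≤ 2 * (D + j : ℕ) / x ^ 3 := by
  have h₀ : overlapPoly D j ≠ 0 := fun h => by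
    simpa [h] using overlapPoly_eval_pos D j le_rfl
  have hr : ∀ r ∈ (overlapPoly D j).roots, r ≤ 0 := by
    intro r hr
    by_contra! hr₀
    exact (overlapPoly_eval_pos D j hr₀.le).ne' (isRoot_of_mem_roots hr)
  have hd := natDegree_overlapPoly_le D j
  obtain ⟨h₁, h₂⟩ := (splits_overlapPoly D j).abs_logDeriv_le h₀ hr hx
  exact ⟨h₁.trans (by gcongr), h₂.trans (by gcongr)⟩

theorem coeff_overlapPoly_succ (D j m : ℕ) :
    ((m : ℝ) + 1) ^ 2 * (overlapPoly D j).coeff (m + 1) =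
      ((D + j) * (j + 1) + (D - 1) * m - m ^ 2) * (overlapPoly D j).coeff m := by
  have h₁ : ((D + j).choose (m + 1) : ℝ) * (m + 1) = (D + j).choose m * (D + j - m) := by
    rcases le_or_gt m (D + j) with h | h
    · have := Nat.choose_succ_right_eq (D + j) m
      zify [h] at this
      exact_mod_cast this
    · rw [Nat.choose_eq_zero_of_lt h, Nat.choose_eq_zero_of_lt (by omega)]
      simp
  have h₂ : ((j : ℝ) + m + 1) * (j + m).choose m = (j + (m + 1)).choose (m + 1) * (m + 1) := by
    exact_mod_cast Nat.add_one_mul_choose_eq (j + m) m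
  rw [coeff_overlapPoly, coeff_overlapPoly]
  calc _ = ((D + j).choose (m + 1) * ((m : ℝ) + 1)) *
        ((j + (m + 1)).choose (m + 1) * ((m : ℝ) + 1)) := by ring
    _ = _ := by rw [h₁, ← h₂]; ring

/-- The hypergeometric equation. -/
theorem overlapPoly_ode (D j : ℕ) :
    (X + X ^ 2) * derivative (derivative (overlapPoly D j))
      + (1 + C (2 - (D : ℝ)) * X) * derivative (overlapPoly D j) =
    C (((D : ℝ) + j) * (j + 1)) * overlapPoly D j := by
  have h : (X + X ^ 2) * derivative (derivative (overlapPoly D j))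
      + (1 + C (2 - (D : ℝ)) * X) * derivative (overlapPoly D j) =
      derivative (derivative (overlapPoly D j)) * X ^ 1 +
      derivative (derivative (overlapPoly D j)) * X ^ 2 + derivative (overlapPoly D j) +
      C (2 - (D : ℝ)) * (derivative (overlapPoly D j) * X ^ 1) := by ring
  rw [h]
  ext m
  have h₁ := coeff_overlapPoly_succ D j m
  simp only [coeff_add, coeff_C_mul, coeff_mul_X_pow', coeff_derivative]
  match m with
  | 0 => simp at h₁ ⊢; linarith
  | 1 => simp at h₁ ⊢; linarith
  | m + 2 =>
    simp at h₁ ⊢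
    rw [show m + 1 + 1 = m + 2 by rfl]
    linear_combination h₁

/-- The derivative of the Riccati equation satisfied by the logarithmic derivative. -/
theorem overlapPoly_riccati (D j : ℕ) {x : ℝ} (hx : 0 < x) :
    x * (1 + x) * (logDerivThree (overlapPoly D j) x +
        2 * ((derivative (overlapPoly D j)).eval x / (overlapPoly D j).eval x) *
          logDerivTwo (overlapPoly D j) x)
      + (1 + 2 * x) * (logDerivTwo (overlapPoly D j) x +
        ((derivative (overlapPoly D j)).eval x / (overlapPoly D j).eval x) ^ 2)
      + (1 + (2 - D) * x) * logDerivTwo (overlapPoly D j) x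
      + (2 - D) * ((derivative (overlapPoly D j)).eval x / (overlapPoly D j).eval x) = 0 := by
  have h := overlapPoly_ode D j
  have h₁ := congrArg (eval x) h
  have h₂ := congrArg (fun p => eval x (derivative p)) h
  have h₀ := (overlapPoly_eval_pos D j hx.le).ne'
  simp only [derivative_mul, derivative_add, derivative_X, derivative_X_pow, derivative_C,
    derivative_one, eval_add, eval_mul, eval_pow, eval_X, eval_C, eval_one, eval_zero,
    map_ofNat, eval_ofNat, Nat.cast_ofNat] at h₁ h₂
  rw [logDerivTwo, logDerivThree]
  field_simp
  linear_combination (overlapPoly D j).eval x ^ 2 * h₂ -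
    (overlapPoly D j).eval x * (derivative (overlapPoly D j)).eval x * h₁

end Polynomials

/-- The prefactor of `overlapDist N (N + D) j`. -/
noncomputable def overlapWeight (D N j : ℕ) : ℝ :=
  (D + 2 * j + 1) * N.factorial * (N + D).factorial /
    ((N - j).factorial * (N + D + j + 1).factorial)

theorem overlapWeight_pos (D N j : ℕ) : 0 < overlapWeight D N j := by
  unfold overlapWeight; positivity

theorem overlapWeight_eq_descFactorial {D N j : ℕ} (h : j ≤ N) :
    overlapWeight D N j =
      (D + 2 * j + 1) * N.descFactorial j * (N + D).factorial / (N + D + j + 1).factorial := by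
  rw [overlapWeight, ← Nat.factorial_mul_descFactorial h]
  push_cast
  field_simp

theorem sum_range_overlapWeight {D N n : ℕ} (h : n ≤ N + 1) :
    ∑ j ∈ Finset.range n, overlapWeight D N j =
      1 - N.descFactorial n * (N + D).factorial / (N + D + n).factorial := by
  induction n with
  | zero => simp [Nat.factorial_ne_zero]
  | succ n ih =>
    have hn : n ≤ N := by omega
    rw [Finset.sum_range_succ, ih (by omega), overlapWeight_eq_descFactorial hn,
      Nat.descFactorial_succ, ← add_assoc, Nat.factorial_succ (N + D + n)]
    push_cast [hn]
    field_simp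
    ring

theorem sum_overlapWeight (D N : ℕ) :
    ∑ j ∈ Finset.range (N + 1), overlapWeight D N j = 1 := by
  rw [sum_range_overlapWeight le_rfl, Nat.descFactorial_of_lt N.lt_succ_self]
  simp

theorem overlapWeight_succ {D N j : ℕ} (h : j ≤ N) :
    (((N : ℝ) + 1) * (N + D + 2) + D - (D + j) * (j + 1)) * overlapWeight D (N + 1) j =
      (N + 1) * (N + D + 1) * overlapWeight D N j := by
  rw [overlapWeight, overlapWeight, show N + 1 - j = N - j + 1 by omega,
    show N + 1 + D + j + 1 = N + D + j + 1 + 1 by omega, show N + 1 + D = N + D + 1 by omega,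
    Nat.factorial_succ N, Nat.factorial_succ (N + D), Nat.factorial_succ (N - j),
    Nat.factorial_succ (N + D + j + 1)]
  have h₁ : (N : ℝ) - j + 1 ≠ 0 := by
    have : (j : ℝ) ≤ N := by exact_mod_cast h
    linarith
  push_cast [h]
  field_simp
  ring

theorem sum_overlapWeight_mul_coeff (D N m : ℕ) :
    ∑ j ∈ Finset.range (N + 1), overlapWeight D N j * (overlapPoly D j).coeff m =
      (N + D).choose m := by
  induction N generalizing m with
  | zero =>
    simp [overlapWeight, coeff_overlapPoly, Nat.factorial_succ]
    field_simp
  | succ N ih =>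
    induction m with
    | zero => simpa [coeff_overlapPoly] using sum_overlapWeight D (N + 1)
    | succ m ihm =>
      set μ : ℝ := ((N : ℝ) + 1) * (N + D + 2) + D with hμ
      have h₁ : ∑ j ∈ Finset.range (N + 1 + 1), (μ - (D + j) * (j + 1)) *
          (overlapWeight D (N + 1) j * (overlapPoly D j).coeff m) =
          (N + 1) * (N + D + 1) * (N + D).choose m := by
        rw [Finset.sum_range_succ, ← ih, Finset.mul_sum]
        have : μ - (D + (N + 1 : ℕ)) * ((N + 1 : ℕ) + 1) = 0 := by rw [hμ]; push_cast; ring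
        rw [this, zero_mul, add_zero]
        refine Finset.sum_congr rfl fun j hj => ?_
        rw [← mul_assoc, overlapWeight_succ (by simpa [Nat.lt_succ_iff] using hj)]
        ring
      have h₂ : ((m : ℝ) + 1) ^ 2 * ∑ j ∈ Finset.range (N + 1 + 1),
          overlapWeight D (N + 1) j * (overlapPoly D j).coeff (m + 1) =
          (μ + (D - 1) * m - m ^ 2) * (N + 1 + D).choose m -
            (N + 1) * (N + D + 1) * (N + D).choose m := by
        rw [← h₁, ← ihm, Finset.mul_sum, Finset.mul_sum, ← Finset.sum_sub_distrib]
        refine Finset.sum_congr rfl fun j _ => ?_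
        linear_combination overlapWeight D (N + 1) j * coeff_overlapPoly_succ D j m
      have h₃ : ((N + 1 + D).choose (m + 1) : ℝ) * (m + 1) =
          (N + D + 1) * (N + D).choose m := by
        have := Nat.add_one_mul_choose_eq (N + D) m
        rw [show N + 1 + D = N + D + 1 by omega]
        exact_mod_cast this.symm
      have h₄ : ((N + 1 + D).choose (m + 1) : ℝ) * (m + 1) =
          (N + 1 + D).choose m * (N + D + 1 - m) := by
        rcases le_or_gt m (N + 1 + D) with h | h
        · have := Nat.choose_succ_right_eq (N + 1 + D) m
          zify [h] at this
          have h' : ((N + 1 + D).choose (m + 1) : ℝ) * (m + 1) =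
            (N + 1 + D).choose m * (N + 1 + D - m) := by exact_mod_cast this
          rw [h']; ring
        · rw [Nat.choose_eq_zero_of_lt h, Nat.choose_eq_zero_of_lt (by omega)]
          simp
      have h₅ : ((m : ℝ) + 1) ^ 2 ≠ 0 := by positivity
      refine mul_left_cancel₀ h₅ (h₂.trans ?_)
      rw [hμ]
      linear_combination ((N : ℝ) + 1) * h₃ - (N + m + 2 : ℝ) * h₄

section Identities

open Polynomial

theorem sum_overlapWeight_smul_overlapPoly (D N : ℕ) :
    ∑ j ∈ Finset.range (N + 1), C (overlapWeight D N j) * overlapPoly D j =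
      (1 + X) ^ (N + D) := by
  ext m
  simp only [finsetSum_coeff, coeff_C_mul, coeff_one_add_X_pow]
  exact sum_overlapWeight_mul_coeff D N m

theorem sum_overlapWeight_eval (D N : ℕ) (x : ℝ) :
    ∑ j ∈ Finset.range (N + 1), overlapWeight D N j * (overlapPoly D j).eval x =
      (1 + x) ^ (N + D) := by
  simpa [eval_finsetSum] using congrArg (eval x) (sum_overlapWeight_smul_overlapPoly D N)

theorem sum_overlapWeight_eval_derivative (D N : ℕ) {x : ℝ} (hx : 0 < x) :
    ∑ j ∈ Finset.range (N + 1), overlapWeight D N j * (derivative (overlapPoly D j)).eval x =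
      (1 + x) ^ (N + D) * ((N + D) / (1 + x)) := by
  have h := congrArg (fun p => eval x (derivative p)) (sum_overlapWeight_smul_overlapPoly D N)
  simp only [derivative_sum, derivative_C_mul, eval_finsetSum, eval_mul, eval_C, derivative_pow,
    derivative_add, derivative_one, derivative_X, zero_add, eval_pow, eval_add, eval_one, eval_X,
    mul_one] at h
  rw [h]
  have : 1 + x ≠ 0 := by positivity
  rcases Nat.eq_zero_or_pos (N + D) with h₀ | h₀
  · have : (N : ℝ) + D = 0 := by exact_mod_cast h₀
    simp [h₀, this]
  · obtain ⟨k, hk⟩ := Nat.exists_eq_add_of_lt h₀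
    have h₁ : (N : ℝ) + D = k + 1 := by exact_mod_cast hk.trans (by omega)
    rw [h₁, hk]
    simp
    field_simp
    ring

theorem sum_overlapWeight_eval_derivative_two (D N : ℕ) {x : ℝ} (hx : 0 < x) :
    ∑ j ∈ Finset.range (N + 1),
        overlapWeight D N j * (derivative (derivative (overlapPoly D j))).eval x =
      (1 + x) ^ (N + D) * ((N + D) * (N + D - 1) / (1 + x) ^ 2) := by
  have h := congrArg (fun p => eval x (derivative (derivative p)))
    (sum_overlapWeight_smul_overlapPoly D N)
  simp only [derivative_sum, derivative_C_mul, eval_finsetSum, eval_mul, eval_C, derivative_pow,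
    derivative_add, derivative_one, derivative_X, zero_add, eval_pow, eval_add, eval_one, eval_X,
    mul_one] at h
  rw [h]
  have : 1 + x ≠ 0 := by positivity
  obtain h₀ | h₀ | ⟨k, hk⟩ : N + D = 0 ∨ N + D = 1 ∨ ∃ k, N + D = k + 2 := by
    rcases h : N + D with _ | _ | k
    · simp
    · simp
    · exact .inr (.inr ⟨k, rfl⟩)
  · have : (N : ℝ) + D = 0 := by exact_mod_cast h₀
    simp [h₀, this]
  · have : (N : ℝ) + D = 1 := by exact_mod_cast h₀
    simp [h₀, this]
  · have h₁ : (N : ℝ) + D = k + 2 := by exact_mod_cast hk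
    rw [h₁, hk]
    simp
    field_simp
    ring

end Identities

/-- The variance of the logarithmic derivative `f`, when the derivative of its Riccati equation
holds and its first two moments are those of the binomial-type normalization `(1 + x) ^ M`. -/
theorem abs_variance_sub_le {ι : Type*} (s : Finset ι) (p f g h : ι → ℝ) {M x d : ℝ}
    (hM : 1 ≤ M) (hx : 0 < x) (hp : ∀ i ∈ s, 0 ≤ p i) (hp₁ : ∑ i ∈ s, p i = 1)
    (hf : ∑ i ∈ s, p i * f i = M / (1 + x))
    (hg : ∑ i ∈ s, p i * (g i + f i ^ 2) = M * (M - 1) / (1 + x) ^ 2)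
    (hg' : ∀ i ∈ s, |g i| ≤ M / x ^ 2) (hh' : ∀ i ∈ s, |h i| ≤ 2 * M / x ^ 3)
    (hode : ∀ i ∈ s, x * (1 + x) * (h i + 2 * f i * g i) + (1 + 2 * x) * (g i + f i ^ 2) +
      (1 + (2 - d) * x) * g i + (2 - d) * f i = 0) :
    |2 * x * M * ∑ i ∈ s, p i * (f i - M / (1 + x)) ^ 2 - M ^ 2 / (1 + x) ^ 2| ≤
      (x * (1 + x) * (2 / x ^ 3 + (1 + 1 / x ^ 2) / x ^ 2) + (1 + 2 * x) / (1 + x) ^ 2 +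
        |1 + (2 - d) * x| * (1 / x ^ 2 + 1 / (1 + x) ^ 2) + |2 - d| / (1 + x)) *
        (M * √M) := by
  set t := M / (1 + x) with ht
  set v := ∑ i ∈ s, p i * (f i - t) ^ 2 with hv
  have hx₁ : 0 < 1 + x := by positivity
  have hr₀ : 0 < √M := Real.sqrt_pos.2 (by linarith)
  have hr₁ : 1 ≤ √M := Real.one_le_sqrt.2 hM
  have hrr : √M * √M = M := Real.mul_self_sqrt (by linarith)
  have hMr : M ≤ M * √M := le_mul_of_one_le_right (by linarith) hr₁
  have hmean : ∀ (k : ι → ℝ) (b : ℝ), (∀ i ∈ s, |k i| ≤ b) → |∑ i ∈ s, p i * k i| ≤ b := by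
    intro k b hk
    calc |∑ i ∈ s, p i * k i| ≤ ∑ i ∈ s, |p i * k i| := Finset.abs_sum_le_sum_abs _ _
      _ ≤ ∑ i ∈ s, p i * b := Finset.sum_le_sum fun i hi => by
        rw [abs_mul, abs_of_nonneg (hp i hi)]
        exact mul_le_mul_of_nonneg_left (hk i hi) (hp i hi)
      _ = b := by rw [← Finset.sum_mul, hp₁, one_mul]
  have hf₂ : ∑ i ∈ s, p i * f i ^ 2 = v + t ^ 2 := by
    have : v = ∑ i ∈ s, p i * f i ^ 2 - 2 * t * ∑ i ∈ s, p i * f i + t ^ 2 * ∑ i ∈ s, p i := by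
      rw [hv, Finset.mul_sum, Finset.mul_sum, ← Finset.sum_sub_distrib, ← Finset.sum_add_distrib]
      exact Finset.sum_congr rfl fun i _ => by ring
    rw [this, hf, hp₁]; ring
  have hgm : ∑ i ∈ s, p i * g i = -(v + M / (1 + x) ^ 2) := by
    have h₁ : ∑ i ∈ s, p i * (g i + f i ^ 2) = ∑ i ∈ s, p i * g i + ∑ i ∈ s, p i * f i ^ 2 := by
      rw [← Finset.sum_add_distrib]
      exact Finset.sum_congr rfl fun i _ => by ring
    rw [h₁, hf₂, ht] at hg
    rw [eq_sub_of_add_eq hg]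
    field_simp
    ring
  have hv₀ : 0 ≤ v := Finset.sum_nonneg fun i hi => mul_nonneg (hp i hi) (sq_nonneg _)
  have hv₁ : v ≤ M / x ^ 2 := by
    have h₁ := (abs_le.1 (hmean g _ hg')).1
    have : 0 ≤ M / (1 + x) ^ 2 := by positivity
    linarith
  set A := ∑ i ∈ s, p i * h i
  set B := ∑ i ∈ s, p i * ((f i - t) * g i) with hB
  have hA₁ : |A| ≤ 2 * M / x ^ 3 := hmean h _ hh'
  have hB₁ : |B| ≤ (√M + v / √M) / 2 * (M / x ^ 2) := by
    calc |B| ≤ ∑ i ∈ s, |p i * ((f i - t) * g i)| := Finset.abs_sum_le_sum_abs _ _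
      _ ≤ ∑ i ∈ s, p i * (((√M + (f i - t) ^ 2 / √M) / 2) * (M / x ^ 2)) := by
        refine Finset.sum_le_sum fun i hi => ?_
        rw [abs_mul, abs_of_nonneg (hp i hi), abs_mul]
        refine mul_le_mul_of_nonneg_left ?_ (hp i hi)
        refine mul_le_mul ?_ (hg' i hi) (abs_nonneg _) (by positivity)
        rw [← sq_abs (f i - t), ← sub_nonneg]
        have : (√M + |f i - t| ^ 2 / √M) / 2 - |f i - t| = (√M - |f i - t|) ^ 2 / (2 * √M) := by
          field_simp
          ring
        rw [this]
        positivity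
      _ = (√M * ∑ i ∈ s, p i + v / √M) / 2 * (M / x ^ 2) := by
        rw [hv, Finset.mul_sum, Finset.sum_div, ← Finset.sum_add_distrib, Finset.sum_div,
          Finset.sum_mul]
        exact Finset.sum_congr rfl fun i _ => by ring
      _ = _ := by rw [hp₁, mul_one]
  have hB₂ : |2 * B| ≤ (1 + 1 / x ^ 2) / x ^ 2 * (M * √M) := by
    rw [abs_mul, abs_two]
    have h₁ : v / √M ≤ √M / x ^ 2 := by
      rw [div_le_iff₀ hr₀, div_mul_eq_mul_div, hrr]
      exact hv₁
    calc 2 * |B| ≤ 2 * ((√M + √M / x ^ 2) / 2 * (M / x ^ 2)) := by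
          have := hB₁.trans (by gcongr : _ ≤ (√M + √M / x ^ 2) / 2 * (M / x ^ 2))
          linarith
      _ = _ := by field_simp
  have hsum : x * (1 + x) * (A + 2 * B + 2 * t * ∑ i ∈ s, p i * g i) +
      (1 + 2 * x) * ∑ i ∈ s, p i * (g i + f i ^ 2) +
      (1 + (2 - d) * x) * ∑ i ∈ s, p i * g i + (2 - d) * ∑ i ∈ s, p i * f i = 0 := by
    rw [hB]
    simp only [A, Finset.mul_sum, ← Finset.sum_add_distrib]
    refine Finset.sum_eq_zero fun i hi => ?_
    linear_combination p i * hode i hi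
  rw [hg, hgm, hf, ht] at hsum
  have hmain : 2 * x * M * v - M ^ 2 / (1 + x) ^ 2 =
      x * (1 + x) * (A + 2 * B) - (1 + 2 * x) / (1 + x) ^ 2 * M -
        (1 + (2 - d) * x) * (v + M / (1 + x) ^ 2) + (2 - d) / (1 + x) * M := by
    field_simp at hsum ⊢
    linear_combination -hsum
  rw [hmain]
  have hA₂ : |A| ≤ 2 / x ^ 3 * (M * √M) :=
    hA₁.trans (by rw [mul_div_right_comm]; gcongr)
  have e₁ : |x * (1 + x) * (A + 2 * B)| ≤
      x * (1 + x) * (2 / x ^ 3 + (1 + 1 / x ^ 2) / x ^ 2) * (M * √M) := by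
    rw [abs_mul, abs_of_pos (by positivity : 0 < x * (1 + x)), mul_assoc _ _ (M * √M), add_mul]
    exact mul_le_mul_of_nonneg_left ((abs_add_le _ _).trans (add_le_add hA₂ hB₂)) (by positivity)
  have e₂ : |(1 + 2 * x) / (1 + x) ^ 2 * M| ≤ (1 + 2 * x) / (1 + x) ^ 2 * (M * √M) := by
    rw [abs_of_nonneg (by positivity)]
    gcongr
  have e₃ : |(1 + (2 - d) * x) * (v + M / (1 + x) ^ 2)| ≤
      |1 + (2 - d) * x| * (1 / x ^ 2 + 1 / (1 + x) ^ 2) * (M * √M) := by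
    rw [abs_mul, mul_assoc]
    refine mul_le_mul_of_nonneg_left ?_ (abs_nonneg _)
    rw [abs_of_nonneg (by positivity)]
    calc v + M / (1 + x) ^ 2 ≤ M / x ^ 2 + M / (1 + x) ^ 2 := by gcongr
      _ = (1 / x ^ 2 + 1 / (1 + x) ^ 2) * M := by ring
      _ ≤ _ := by gcongr
  have e₄ : |(2 - d) / (1 + x) * M| ≤ |2 - d| / (1 + x) * (M * √M) := by
    rw [abs_mul, abs_div, abs_of_pos hx₁, abs_of_nonneg (by linarith : (0 : ℝ) ≤ M)]
    gcongr
  refine (abs_add_le _ _).trans ?_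
  have e₅ := abs_sub (x * (1 + x) * (A + 2 * B) - (1 + 2 * x) / (1 + x) ^ 2 * M)
    ((1 + (2 - d) * x) * (v + M / (1 + x) ^ 2))
  have e₆ := abs_sub (x * (1 + x) * (A + 2 * B)) ((1 + 2 * x) / (1 + x) ^ 2 * M)
  linarith

section Scores

open Polynomial

/-- The Fisher information, up to the factor `(dx/dc)²`, in the coordinate `x = c / (1 - c)`. -/
noncomputable def scoreVariance (D N : ℕ) (x : ℝ) : ℝ :=
  ∑ j ∈ Finset.range (N + 1),
    overlapWeight D N j * (overlapPoly D j).eval x / (1 + x) ^ (N + D) *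
      ((derivative (overlapPoly D j)).eval x / (overlapPoly D j).eval x - (N + D) / (1 + x)) ^ 2

theorem exists_abs_scoreVariance_sub_le (D : ℕ) {x : ℝ} (hx : 0 < x) :
    ∃ K : ℝ, ∀ N : ℕ, 1 ≤ N →
      |2 * x * (N + D) * scoreVariance D N x - (N + D) ^ 2 / (1 + x) ^ 2| ≤
        K * ((N + D) * √(N + D)) := by
  refine ⟨x * (1 + x) * (2 / x ^ 3 + (1 + 1 / x ^ 2) / x ^ 2) + (1 + 2 * x) / (1 + x) ^ 2 +
    |1 + (2 - (D : ℝ)) * x| * (1 / x ^ 2 + 1 / (1 + x) ^ 2) + |2 - (D : ℝ)| / (1 + x),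
    fun N hN => ?_⟩
  have hx₁ : (1 + x) ^ (N + D) ≠ 0 := by positivity
  have hP : ∀ j, (overlapPoly D j).eval x ≠ 0 := fun j => (overlapPoly_eval_pos D j hx.le).ne'
  have hle : ∀ j ∈ Finset.range (N + 1), ((D + j : ℕ) : ℝ) ≤ N + D := by
    intro j hj
    have := Finset.mem_range.1 hj
    exact_mod_cast (by omega : D + j ≤ N + D)
  refine abs_variance_sub_le (d := D) _ _ _ (fun j => logDerivTwo (overlapPoly D j) x)
    (fun j => logDerivThree (overlapPoly D j) x) ?_ hx ?_ ?_ ?_ ?_ ?_ ?_ ?_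
  · have : (1 : ℝ) ≤ N := by exact_mod_cast hN
    linarith [(Nat.cast_nonneg D : (0 : ℝ) ≤ D)]
  · intro j _
    have := overlapWeight_pos D N j
    have := overlapPoly_eval_pos D j hx.le
    positivity
  · rw [← Finset.sum_div, sum_overlapWeight_eval, div_self hx₁]
  · rw [← mul_right_inj' hx₁, ← sum_overlapWeight_eval_derivative D N hx, Finset.mul_sum]
    refine Finset.sum_congr rfl fun j _ => ?_
    have := hP j
    field_simp
  · rw [← mul_right_inj' hx₁, ← sum_overlapWeight_eval_derivative_two D N hx, Finset.mul_sum]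
    refine Finset.sum_congr rfl fun j _ => ?_
    have := hP j
    rw [logDerivTwo]
    field_simp
    ring
  · exact fun j hj => (abs_logDeriv_overlapPoly_le D j hx).1.trans (by gcongr; exact hle j hj)
  · exact fun j hj => (abs_logDeriv_overlapPoly_le D j hx).2.trans (by gcongr; exact hle j hj)
  · exact fun j _ => overlapPoly_riccati D j hx

theorem tendsto_scoreVariance (D : ℕ) {x : ℝ} (hx : 0 < x) :
    Tendsto (fun N : ℕ => scoreVariance D N x / ((N : ℝ) + D)) atTop
      (nhds (1 / (2 * x * (1 + x) ^ 2))) := by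
  obtain ⟨K, hK⟩ := exists_abs_scoreVariance_sub_le D hx
  have hM : Tendsto (fun N : ℕ => (N : ℝ) + D) atTop atTop :=
    tendsto_atTop_add_const_right _ _ tendsto_natCast_atTop_atTop
  have h₀ : Tendsto (fun N : ℕ => K / (2 * x) * (√((N : ℝ) + D))⁻¹) atTop (nhds 0) := by
    simpa using ((Real.tendsto_sqrt_atTop.comp hM).inv_tendsto_atTop).const_mul (K / (2 * x))
  rw [tendsto_iff_norm_sub_tendsto_zero]
  refine squeeze_zero' (.of_forall fun _ => norm_nonneg _) ?_ h₀
  filter_upwards [eventually_ge_atTop 1] with N hN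
  have hpos : 0 < (N : ℝ) + D := by positivity
  have hr : √((N : ℝ) + D) * √((N : ℝ) + D) = N + D := Real.mul_self_sqrt hpos.le
  have hr₀ : 0 < √((N : ℝ) + D) := Real.sqrt_pos.2 hpos
  have h₁ : scoreVariance D N x / ((N : ℝ) + D) - 1 / (2 * x * (1 + x) ^ 2) =
      (2 * x * (N + D) * scoreVariance D N x - (N + D) ^ 2 / (1 + x) ^ 2) /
        (2 * x * (N + D) ^ 2) := by
    field_simp
  rw [h₁, Real.norm_eq_abs, abs_div, abs_of_pos (by positivity : 0 < 2 * x * ((N : ℝ) + D) ^ 2),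
    div_le_iff₀ (by positivity)]
  refine (hK N hN).trans_eq ?_
  field_simp
  rw [sq, hr]

theorem overlapDist_eq (D N j : ℕ) (hj : j ≤ N) {c : ℝ} (hc : c < 1) :
    overlapDist N (N + D) j c =
      overlapWeight D N j * ((1 - c) ^ (N + D) * (overlapPoly D j).eval (c / (1 - c))) := by
  have hc' : 1 - c ≠ 0 := by linarith
  rw [overlapDist, overlapWeight, overlapPoly, eval_finsetSum, Nat.add_sub_cancel_left,
    Finset.mul_sum _ _ ((1 - c) ^ (N + D))]
  push_cast
  congr 1
  refine Finset.sum_congr rfl fun m hm => ?_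
  have hm' : m ≤ N + D := by have := Finset.mem_range.1 hm; omega
  simp only [eval_mul, eval_C, eval_pow, eval_X]
  rw [pow_sub₀ _ hc' hm', div_pow]
  field_simp

theorem hasDerivAt_overlapDist (D N j : ℕ) (hj : j ≤ N) {c : ℝ} (hc : c < 1) :
    HasDerivAt (fun y => overlapDist N (N + D) j y)
      (overlapWeight D N j * (-((N + D : ℕ) * (1 - c) ^ (N + D - 1)) *
          (overlapPoly D j).eval (c / (1 - c)) +
        (1 - c) ^ (N + D) *
          ((derivative (overlapPoly D j)).eval (c / (1 - c)) * (1 / (1 - c) ^ 2)))) c := by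
  have hc' : 1 - c ≠ 0 := by linarith
  have h₁ : HasDerivAt (fun y : ℝ => 1 - y) (-1) c := by
    simpa using (hasDerivAt_id c).const_sub 1
  have h₂ : HasDerivAt (fun y : ℝ => y / (1 - y)) (1 / (1 - c) ^ 2) c :=
    ((hasDerivAt_id' c).fun_div h₁ hc').congr_deriv (by ring)
  have h₃ := ((h₁.fun_pow (N + D)).fun_mul
    (((overlapPoly D j).hasDerivAt (c / (1 - c))).comp c h₂)).const_mul (overlapWeight D N j)
  refine (h₃.congr_of_eventuallyEq ?_).congr_deriv (by simp)
  filter_upwards [gt_mem_nhds hc] with y hy using overlapDist_eq D N j hj hy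

theorem fisherInfo_eq_scoreVariance (D N : ℕ) {c : ℝ} (hc : c ∈ Set.Ioo (0 : ℝ) 1) :
    fisherInfo N (N + D) c = scoreVariance D N (c / (1 - c)) / (1 - c) ^ 4 := by
  have hc' : 0 < 1 - c := by linarith [hc.2]
  have hx : 0 < c / (1 - c) := div_pos hc.1 hc'
  have hx₁ : 1 + c / (1 - c) = (1 - c)⁻¹ := by field_simp; ring
  rw [fisherInfo, scoreVariance, Finset.sum_div, hx₁]
  refine Finset.sum_congr rfl fun j hj => ?_
  have hj' : j ≤ N := by simpa [Nat.lt_succ_iff] using hj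
  rw [(hasDerivAt_overlapDist D N j hj' hc.2).deriv, overlapDist_eq D N j hj' hc.2]
  have hP := (overlapPoly_eval_pos D j hx.le).ne'
  have hw := (overlapWeight_pos D N j).ne'
  have hpow : ((N + D : ℕ) : ℝ) * (1 - c) ^ (N + D - 1) * (1 - c) = (N + D) * (1 - c) ^ (N + D) := by
    rcases Nat.eq_zero_or_pos (N + D) with h₀ | h₀
    · have : (N : ℝ) + D = 0 := by exact_mod_cast h₀
      simp [h₀, this]
    · rw [mul_assoc, ← pow_succ, Nat.sub_add_cancel h₀]
      push_cast
      ring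
  rw [← eq_div_iff hc'.ne'] at hpow
  rw [hpow, inv_pow]
  generalize (overlapPoly D j).eval (c / (1 - c)) = P at *
  generalize (derivative (overlapPoly D j)).eval (c / (1 - c)) = P' at *
  field_simp
  ring

end Scores

/-- Fix `D ≥ 0` and `c ∈ (0,1)`. With `M = N + D`, the Fisher information of
`q_{N,M}(·,c)` satisfies `lim_{N→∞} H_N(c)/(2N+D) = 1/(4c(1−c))`; i.e. the Fisher
information is `(M+N)/(4c(1−c))` to leading order. -/
theorem fisherInfo_asymptotics (D : ℕ) (c : ℝ) (hc : c ∈ Set.Ioo (0 : ℝ) 1) :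
    Tendsto (fun N : ℕ => fisherInfo N (N + D) c / (2 * (N : ℝ) + D))
      atTop (nhds (1 / (4 * c * (1 - c)))) := by
  have hc' : 0 < 1 - c := by linarith [hc.2]
  have hc₀ : c ≠ 0 := hc.1.ne'
  have hx : 0 < c / (1 - c) := div_pos hc.1 hc'
  have hM : Tendsto (fun N : ℕ => (N : ℝ) + D) atTop atTop :=
    tendsto_atTop_add_const_right _ _ tendsto_natCast_atTop_atTop
  have h₁ : Tendsto (fun N : ℕ => (2 - (D : ℝ) * ((N : ℝ) + D)⁻¹)⁻¹) atTop (nhds (2 : ℝ)⁻¹) := by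
    have := ((hM.inv_tendsto_atTop.const_mul (D : ℝ)).const_sub 2).inv₀ (by norm_num)
    simpa using this
  have h₂ := ((tendsto_scoreVariance D hx).mul h₁).div_const ((1 - c) ^ 4)
  have hlim : 1 / (2 * (c / (1 - c)) * (1 + c / (1 - c)) ^ 2) * 2⁻¹ / (1 - c) ^ 4 =
      1 / (4 * c * (1 - c)) := by
    have hx₁ : 1 + c / (1 - c) = (1 - c)⁻¹ := by field_simp; ring
    rw [hx₁]
    field_simp
    ring
  rw [hlim] at h₂
  refine h₂.congr' ?_
  filter_upwards [eventually_ge_atTop 1] with N hN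
  have hpos : 0 < (N : ℝ) + D := by positivity
  have hpos₂ : 0 < 2 * (N : ℝ) + D := by positivity
  have h₃ : 2 - (D : ℝ) * ((N : ℝ) + D)⁻¹ = (2 * N + D) / (N + D) := by
    field_simp
    ring
  rw [fisherInfo_eq_scoreVariance D N hc, h₃]
  field_simp
end

section
/- Let d ≥ 2, M ≥ N ≥ 0 be integers with D = M − N, and let j ∈ {0,1,…,N}. Then the marginal probability of measurement outcome j under the prior density p_d(c) = (d−1)(1−c)^{d−2} has the closed form: ∫_0^1 (d−1)·(1−c)^{d−2}·q_{N,M}(j,c) dc = [(D+2j+1)·(d+M+j−1)!·(d+N−j−2)! / ((d−1)!·(d−2)!·(M+j+1)!·(N−j)!)] / [C(N+d−1, d−1)·C(M+d−1, d−1)]; this equals χ_J/(χ_{N/2}·χ_{M/2}), the ratio of the dimension of the SU(d) irrep labeled by J = (D+2j)/2 (given by the hook-length formula) to the product of the dimensions of the completely symmetric representations on N and M qudits. -/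
open Finset intervalIntegral

open Nat in
theorem sum_antidiagonal_choose_mul_factorial_mul_factorial (a b n : ℕ) :
    (∑ p ∈ antidiagonal n, (n.choose p.1 : ℝ) * (((a + p.1)! : ℝ) * (b + p.2)!)) =
      (a ! : ℝ) * b ! * (a + b + n + 1)! / (a + b + 1)! := by
  induction n generalizing a b with
  | zero => simp [Nat.factorial_ne_zero]
  | succ n ih =>
    rw [Finset.sum_antidiagonal_choose_succ_mul
      (fun x y => ((a + x)! : ℝ) * ((b + y)! : ℝ))]
    have h₁ := ih a (b + 1)
    have h₂ := ih (a + 1) b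
    have hleft : ∀ p ∈ antidiagonal n, (n.choose p.1 : ℝ) * (((a + p.1)! : ℝ) *
        (b + (p.2 + 1))!) = n.choose p.1 * (((a + p.1)! : ℝ) * (b + 1 + p.2)!) := by
      intro p _
      rw [show b + (p.2 + 1) = b + 1 + p.2 by ring]
    have hright : ∀ p ∈ antidiagonal n, (n.choose p.2 : ℝ) * (((a + (p.1 + 1))! : ℝ) *
        (b + p.2)!) = n.choose p.1 * (((a + 1 + p.1)! : ℝ) * (b + p.2)!) := by
      intro p hp
      rw [Nat.choose_symm_of_eq_add (mem_antidiagonal.1 hp).symm,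
        show a + (p.1 + 1) = a + 1 + p.1 by ring]
    rw [Finset.sum_congr rfl hleft, Finset.sum_congr rfl hright]
    rw [h₁, h₂, show a + (b + 1) + n + 1 = a + b + n + 2 by ring,
      show a + 1 + b + n + 1 = a + b + n + 2 by ring,
      show a + b + (n + 1) + 1 = a + b + n + 2 by ring,
      show a + (b + 1) + 1 = (a + b + 1) + 1 by ring,
      show a + 1 + b + 1 = (a + b + 1) + 1 by ring,
      Nat.factorial_succ (a + b + 1), Nat.factorial_succ a, Nat.factorial_succ b]
    push_cast
    have := Nat.factorial_ne_zero (a + b + 1)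
    field_simp
    ring

theorem succ_mul_integral_pow_succ_mul_one_sub_pow (m k : ℕ) :
    ((k : ℝ) + 1) * ∫ c in (0 : ℝ)..1, c ^ (m + 1) * (1 - c) ^ k =
      ((m : ℝ) + 1) * ∫ c in (0 : ℝ)..1, c ^ m * (1 - c) ^ (k + 1) := by
  have hderiv : ∀ x ∈ Set.uIcc (0 : ℝ) 1,
      HasDerivAt (fun c : ℝ => c ^ (m + 1) * (1 - c) ^ (k + 1))
        (((m : ℝ) + 1) * (x ^ m * (1 - x) ^ (k + 1)) -
          ((k : ℝ) + 1) * (x ^ (m + 1) * (1 - x) ^ k)) x := by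
    intro x _
    refine ((hasDerivAt_pow (m + 1) x).mul
      (((hasDerivAt_id x).const_sub 1).pow (k + 1))).congr_deriv ?_
    simp
    ring
  have h := integral_eq_sub_of_hasDerivAt hderiv
    (Continuous.intervalIntegrable (by fun_prop) _ _)
  rw [integral_sub (Continuous.intervalIntegrable (by fun_prop) _ _)
    (Continuous.intervalIntegrable (by fun_prop) _ _), integral_const_mul,
    integral_const_mul] at h
  simp at h
  linarith

open Nat in
theorem integral_pow_mul_one_sub_pow (m k : ℕ) :
    ∫ c in (0 : ℝ)..1, c ^ m * (1 - c) ^ k = (m ! : ℝ) * k ! / (m + k + 1)! := by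
  induction m generalizing k with
  | zero =>
    have h : ∫ c in (0 : ℝ)..1, (1 - c) ^ k = 1 / ((k : ℝ) + 1) := by
      rw [integral_comp_sub_left (fun x : ℝ => x ^ k)]
      simp
    simp only [pow_zero, one_mul, h, Nat.factorial_zero, zero_add, Nat.factorial_succ]
    push_cast
    have := Nat.factorial_ne_zero k
    field_simp
  | succ m ih =>
    have h := succ_mul_integral_pow_succ_mul_one_sub_pow m k
    rw [ih, show m + (k + 1) + 1 = m + 1 + k + 1 by ring, Nat.factorial_succ k] at h
    rw [Nat.factorial_succ m]
    have hk : (k : ℝ) + 1 ≠ 0 := by positivity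
    apply mul_left_cancel₀ hk
    rw [h]
    push_cast
    ring

open Nat in
theorem integral_one_sub_pow_mul_sum_choose (D e j r : ℕ) :
    (∫ c in (0 : ℝ)..1, (1 - c) ^ e * ∑ m ∈ range (D + j + 1),
      (((D + j).choose m * (j + m).choose m : ℕ) : ℝ) * c ^ m * (1 - c) ^ (D + j + r - m)) =
      ((e + r)! : ℝ) * (e + r + D + 2 * j + 1)! /
        ((e + r + j + 1)! * (e + r + D + j + 1)!) := by
  have hterm : ∀ m ∈ range (D + j + 1),
      (∫ c in (0 : ℝ)..1, (1 - c) ^ e * ((((D + j).choose m * (j + m).choose m : ℕ) : ℝ) *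
        c ^ m * (1 - c) ^ (D + j + r - m))) =
      ((D + j).choose m * (((j + m)! : ℝ) * (e + r + (D + j - m))!)) *
        (1 / (j ! * (e + r + D + j + 1)! : ℝ)) := by
    intro m hm
    obtain ⟨l, hl⟩ := Nat.exists_eq_add_of_le (Nat.le_of_lt_succ (mem_range.1 hm))
    have hchoose : ((j + m)! : ℝ) = (j + m).choose m * (m ! * j !) := by
      rw [Nat.add_comm j m, ← Nat.add_choose_mul_factorial_mul_factorial m j,
        Nat.choose_symm_add]
      push_cast
      ring
    have hint : ∀ c : ℝ, (1 - c) ^ e * ((((D + j).choose m * (j + m).choose m : ℕ) : ℝ) *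
        c ^ m * (1 - c) ^ (D + j + r - m)) =
        (((D + j).choose m * (j + m).choose m : ℕ) : ℝ) * (c ^ m * (1 - c) ^ (e + r + l)) := by
      intro c
      rw [show D + j + r - m = r + l by omega, Nat.add_assoc e, pow_add _ e]
      ring
    simp only [hint]
    rw [integral_const_mul, integral_pow_mul_one_sub_pow, hchoose,
      show D + j - m = l by omega,
      show m + (e + r + l) + 1 = e + r + D + j + 1 by omega]
    push_cast
    have := Nat.factorial_ne_zero j
    field_simp
  simp only [mul_sum]
  rw [integral_finsetSum fun m _ => Continuous.intervalIntegrable (by fun_prop) _ _,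
    Finset.sum_congr rfl hterm, ← Finset.sum_mul, ← Nat.succ_eq_add_one (D + j),
    ← Finset.Nat.sum_antidiagonal_eq_sum_range_succ (fun m l =>
      ((D + j).choose m : ℝ) * (((j + m)! : ℝ) * (e + r + l)!)),
    sum_antidiagonal_choose_mul_factorial_mul_factorial,
    show j + (e + r) + (D + j) + 1 = e + r + D + 2 * j + 1 by ring,
    show j + (e + r) + 1 = e + r + j + 1 by ring]
  have := Nat.factorial_ne_zero j
  field_simp

/-- For `d ≥ 2`, `M ≥ N ≥ 0`, `D = M − N` and `j ∈ {0,…,N}`, the marginal probability of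
outcome `j` under the prior density `p_d(c) = (d−1)(1−c)^{d−2}` equals
`χ_J/(χ_{N/2}·χ_{M/2})`: the ratio of the hook-length-formula dimension of the SU(d)
irrep labeled by `J = (D+2j)/2` to the product of the dimensions of the completely
symmetric representations on `N` and `M` qudits. -/
theorem marginal_outcome_probability (d N M j : ℕ) (hd : 2 ≤ d) (hNM : N ≤ M) (hj : j ≤ N) :
    (∫ c in (0:ℝ)..1, ((d : ℝ) - 1) * (1 - c) ^ (d - 2) * overlapDist N M j c) =
      ((((M - N + 2 * j + 1) : ℕ) * Nat.factorial (d + M + j - 1) *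
          Nat.factorial (d + N - j - 2) : ℝ) /
        ((Nat.factorial (d - 1) : ℝ) * Nat.factorial (d - 2) *
          Nat.factorial (M + j + 1) * Nat.factorial (N - j))) /
      (((N + d - 1).choose (d - 1) : ℝ) * ((M + d - 1).choose (d - 1) : ℝ)) := by
  obtain ⟨D, rfl⟩ := Nat.exists_eq_add_of_le hNM
  obtain ⟨r, rfl⟩ := Nat.exists_eq_add_of_le hj
  obtain ⟨e, rfl⟩ := Nat.exists_eq_add_of_le' hd
  have hint : ∀ c : ℝ, (((e + 2 : ℕ) : ℝ) - 1) * (1 - c) ^ (e + 2 - 2) *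
      overlapDist (j + r) (j + r + D) j c =
      ((((e + 2 : ℕ) : ℝ) - 1) *
        ((((D + 2 * j + 1) * Nat.factorial (j + r) * Nat.factorial (j + r + D) : ℕ) : ℝ) /
          ((Nat.factorial r * Nat.factorial (j + r + D + j + 1) : ℕ) : ℝ))) *
        ((1 - c) ^ e * ∑ m ∈ range (D + j + 1),
          (((D + j).choose m * (j + m).choose m : ℕ) : ℝ) * c ^ m *
            (1 - c) ^ (D + j + r - m)) := by
    intro c
    rw [overlapDist, show j + r + D - (j + r) = D by omega, show j + r - j = r by omega,
      show j + r + D = D + j + r by ring, Nat.add_sub_cancel]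
    ring
  simp only [hint]
  rw [integral_const_mul, integral_one_sub_pow_mul_sum_choose,
    show j + r + D - (j + r) = D by omega, show j + r - j = r by omega,
    show e + 2 - 2 = e by omega, show e + 2 - 1 = e + 1 by omega,
    show e + 2 + (j + r + D) + j - 1 = e + r + D + 2 * j + 1 by omega,
    show e + 2 + (j + r) - j - 2 = e + r by omega,
    show j + r + (e + 2) - 1 = j + r + (e + 1) by omega,
    show j + r + D + (e + 2) - 1 = j + r + D + (e + 1) by omega,
    ← Nat.choose_symm_add, ← Nat.choose_symm_add, Nat.cast_add_choose, Nat.cast_add_choose,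
    show j + r + (e + 1) = e + r + j + 1 by ring,
    show j + r + D + (e + 1) = e + r + D + j + 1 by ring, Nat.factorial_succ e]
  push_cast
  have := Nat.factorial_ne_zero e
  have := Nat.factorial_ne_zero r
  have := Nat.factorial_ne_zero (j + r)
  have := Nat.factorial_ne_zero (j + r + D)
  have := Nat.factorial_ne_zero (j + r + D + j + 1)
  have := Nat.factorial_ne_zero (e + r + j + 1)
  have := Nat.factorial_ne_zero (e + r + D + j + 1)
  field_simp
  ring
end
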